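/- arXiv:1607.00481 — 3 statements merged into one kernel-verified Lean document; each statement's English description precedes it below -/
import Mathlib

section
/- For every s ∈ ℂ ∖ {0} there exists a nonzero vector v ∈ V(n,±) such that (κ(K ∓ q^{−n}K′) − s⁻¹E)v = 0 and (κ(K ∓ qⁿK′) + sF)v = 0; moreover Ev₀ = (K ∓ qⁿK′)v₀ = 0 and Fv_n = (K ∓ q^{−n}K′)v_n = 0. Consequently, for each s ∈ ℂ ∖ {0}, setting X = κ(K ∓ q^{−n}K′) − s⁻¹E and Y = κ(K ∓ qⁿK′) + sF, there is a surjective homomorphism of left S-modules from S/(SX + SY) onto V(n,±). -/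
noncomputable section

open FreeAlgebra

/-- The defining relations of the algebra `S`.
Generators: `0 ↦ E`, `1 ↦ F`, `2 ↦ K`, `3 ↦ K′`. -/
inductive SRel (q : ℂ) : FreeAlgebra ℂ (Fin 4) → FreeAlgebra ℂ (Fin 4) → Prop
  | KE : SRel q (ι ℂ 2 * ι ℂ 0) (q • (ι ℂ 0 * ι ℂ 2))
  | KF : SRel q (ι ℂ 2 * ι ℂ 1) (q⁻¹ • (ι ℂ 1 * ι ℂ 2))
  | KK' : SRel q (ι ℂ 2 * ι ℂ 3) (ι ℂ 3 * ι ℂ 2)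
  | K'E : SRel q (ι ℂ 3 * ι ℂ 0) (q⁻¹ • (ι ℂ 0 * ι ℂ 3))
  | K'F : SRel q (ι ℂ 3 * ι ℂ 1) (q • (ι ℂ 1 * ι ℂ 3))
  | EF : SRel q ((q - q⁻¹) • (ι ℂ 0 * ι ℂ 1 - ι ℂ 1 * ι ℂ 0))
      (ι ℂ 2 * ι ℂ 2 - ι ℂ 3 * ι ℂ 3)

/-- The algebra `S`, presented by generators `E, F, K, K′` and the relations above. -/
abbrev SAlg (q : ℂ) : Type := RingQuot (SRel q)

/-- The generator `E` of `S`. -/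
def gE (q : ℂ) : SAlg q := RingQuot.mkAlgHom ℂ (SRel q) (ι ℂ 0)

/-- The generator `F` of `S`. -/
def gF (q : ℂ) : SAlg q := RingQuot.mkAlgHom ℂ (SRel q) (ι ℂ 1)

/-- The generator `K` of `S`. -/
def gK (q : ℂ) : SAlg q := RingQuot.mkAlgHom ℂ (SRel q) (ι ℂ 2)

/-- The generator `K′` of `S`. -/
def gK' (q : ℂ) : SAlg q := RingQuot.mkAlgHom ℂ (SRel q) (ι ℂ 3)


open Matrix

/-- The quantum integer `[m] = (q^m − q^{−m})/(q − q⁻¹)`. -/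
def qint (q : ℂ) (m : ℤ) : ℂ := (q ^ m - q ^ (-m)) / (q - q⁻¹)

/-- The matrix of the operator `K` on `V(n,±)`: `K vᵢ = δ r^{n−2i} vᵢ`. -/
def MK (n : ℕ) (δ r : ℂ) : Matrix (Fin (n + 1)) (Fin (n + 1)) ℂ :=
  fun j i => if i = j then δ * r ^ ((n : ℤ) - 2 * (i.val : ℤ)) else 0

/-- The matrix of the operator `K′` on `V(n,±)`: `K′ vᵢ = εδ r^{2i−n} vᵢ`. -/
def MK' (n : ℕ) (ε δ r : ℂ) : Matrix (Fin (n + 1)) (Fin (n + 1)) ℂ :=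
  fun j i => if i = j then ε * δ * r ^ (2 * (i.val : ℤ) - (n : ℤ)) else 0

/-- The matrix of the operator `F` on `V(n,±)`: `F vᵢ = [n−i] vᵢ₊₁` (and `F vₙ = 0`). -/
def MF (n : ℕ) (q : ℂ) : Matrix (Fin (n + 1)) (Fin (n + 1)) ℂ :=
  fun j i => if j.val = i.val + 1 then qint q ((n : ℤ) - (i.val : ℤ)) else 0

/-- The matrix of the operator `E` on `V(n,±)`: `E vᵢ = ε[i] vᵢ₋₁` (and `E v₀ = 0`). -/
def ME (n : ℕ) (ε q : ℂ) : Matrix (Fin (n + 1)) (Fin (n + 1)) ℂ :=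
  fun j i => if i.val = j.val + 1 then ε * qint q (i.val : ℤ) else 0

theorem q_sub_inv_ne_zero {q : ℂ} (hq0 : q ≠ 0) (hroot : ∀ m : ℕ, 0 < m → q ^ m ≠ 1) :
    q - q⁻¹ ≠ 0 := by
  intro h
  apply hroot 2 two_pos
  field_simp at h
  linear_combination h

theorem qint_ne_zero {q : ℂ} (hq0 : q ≠ 0) (hroot : ∀ m : ℕ, 0 < m → q ^ m ≠ 1) {m : ℤ}
    (hm : 0 < m) : qint q m ≠ 0 := by
  refine div_ne_zero (fun h => ?_) (q_sub_inv_ne_zero hq0 hroot)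
  lift m to ℕ using hm.le
  apply hroot (m + m) (by omega)
  rw [_root_.zpow_neg, zpow_natCast] at h
  have hp : q ^ m ≠ 0 := pow_ne_zero _ hq0
  field_simp at h
  rw [pow_add]
  linear_combination h

theorem aeval_diagonal {ι : Type*} [Fintype ι] [DecidableEq ι] (d : ι → ℂ)
    (p : Polynomial ℂ) :
    Polynomial.aeval (diagonal d) p = diagonal fun i => p.eval (d i) := by
  induction p using Polynomial.induction_on' with
  | add p₁ p₂ h₁ h₂ => simp [h₁, h₂, diagonal_add]
  | monomial m a =>
    rw [Polynomial.aeval_monomial, diagonal_pow, algebraMap_eq_diagonal, diagonal_mul_diagonal]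
    simp

/-- A vector with nonzero coordinates is cyclic for a diagonal matrix with distinct entries. -/
theorem exists_aeval_diagonal_mulVec_eq {ι : Type*} [Fintype ι] [DecidableEq ι] {d v : ι → ℂ}
    (hd : Function.Injective d) (hv : ∀ i, v i ≠ 0) (w : ι → ℂ) :
    ∃ p : Polynomial ℂ, (Polynomial.aeval (diagonal d) p) *ᵥ v = w := by
  refine ⟨Lagrange.interpolate Finset.univ d fun i => w i / v i, ?_⟩
  ext i
  rw [aeval_diagonal, mulVec_diagonal,
    Lagrange.eval_interpolate_at_node _ hd.injOn (Finset.mem_univ i), div_mul_cancel₀ _ (hv i)]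

theorem MK_eq_diagonal (n : ℕ) (δ r : ℂ) :
    MK n δ r = diagonal fun i : Fin (n + 1) => δ * r ^ ((n : ℤ) - 2 * (i.val : ℤ)) := by
  ext j i
  by_cases h : i = j
  · simp [MK, h]
  · simp [MK, h, diagonal_apply_ne _ (Ne.symm h)]

theorem MK'_eq_diagonal (n : ℕ) (ε δ r : ℂ) :
    MK' n ε δ r =
      diagonal fun i : Fin (n + 1) => ε * δ * r ^ (2 * (i.val : ℤ) - (n : ℤ)) := by
  ext j i
  by_cases h : i = j
  · simp [MK', h]
  · simp [MK', h, diagonal_apply_ne _ (Ne.symm h)]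

theorem K_eigenvalues_injective {q : ℂ} (hq0 : q ≠ 0) (hroot : ∀ m : ℕ, 0 < m → q ^ m ≠ 1)
    {r : ℂ} (hr : r ^ 2 = q) (n : ℕ) {δ : ℂ} (hδ : δ ≠ 0) :
    Function.Injective fun i : Fin (n + 1) => δ * r ^ ((n : ℤ) - 2 * (i.val : ℤ)) := by
  subst hr
  have hr0 : r ≠ 0 := by rintro rfl; simp at hq0
  intro i j hij
  by_contra hne
  wlog hlt : i < j generalizing i j
  · exact this hij.symm (Ne.symm hne) (lt_of_le_of_ne (not_lt.mp hlt) (Ne.symm hne))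
  have h := mul_left_cancel₀ hδ hij
  apply hroot (j.val - i.val) (by omega)
  rw [← pow_mul, ← zpow_natCast]
  have e : ((2 * (j.val - i.val) : ℕ) : ℤ) =
      ((n : ℤ) - 2 * (i.val : ℤ)) - ((n : ℤ) - 2 * (j.val : ℤ)) := by omega
  rw [e, zpow_sub₀ hr0, h, div_self (zpow_ne_zero _ hr0)]

theorem zpow_natCast_sub_two_mul {r : ℂ} (hr0 : r ≠ 0) (n i : ℕ) :
    r ^ ((n : ℤ) - 2 * (i : ℤ)) = r ^ n * ((r ^ 2) ^ i)⁻¹ := by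
  rw [zpow_sub₀ hr0, _root_.zpow_mul, zpow_natCast, zpow_natCast]; rfl

theorem zpow_two_mul_sub_natCast {r : ℂ} (hr0 : r ≠ 0) (n i : ℕ) :
    r ^ (2 * (i : ℤ) - (n : ℤ)) = (r ^ 2) ^ i * (r ^ n)⁻¹ := by
  rw [zpow_sub₀ hr0, _root_.zpow_mul, zpow_natCast, zpow_natCast]; rfl

theorem kappa_mul_K_sub_pow_mul_K' {q : ℂ} (hq0 : q ≠ 0) {r : ℂ} (hr : r ^ 2 = q) (n : ℕ)
    {ε : ℂ} (hε : ε * ε = 1) (δ : ℂ) (i : ℕ) :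
    (q⁻¹ - q)⁻¹ * (δ * r ^ ((n : ℤ) - 2 * (i : ℤ))
      - ε * q ^ n * (ε * δ * r ^ (2 * (i : ℤ) - (n : ℤ)))) = δ * r ^ n * qint q i := by
  subst hr
  have hr0 : r ≠ 0 := by rintro rfl; simp at hq0
  have h₃ : (r ^ 2) ^ n = r ^ n * r ^ n := by ring
  have hn : r ^ n * (r ^ n)⁻¹ = 1 := mul_inv_cancel₀ (pow_ne_zero _ hr0)
  have h₄ : (r ^ 2 - (r ^ 2)⁻¹)⁻¹ = -((r ^ 2)⁻¹ - r ^ 2)⁻¹ := by rw [← inv_neg, neg_sub]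
  rw [zpow_natCast_sub_two_mul hr0, zpow_two_mul_sub_natCast hr0, h₃, qint, _root_.zpow_neg, zpow_natCast, div_eq_mul_inv, h₄]
  linear_combination (-((r ^ 2)⁻¹ - r ^ 2)⁻¹ * r ^ n * δ * (r ^ 2) ^ i) *
    (hε * (r ^ n * (r ^ n)⁻¹) + hn)

theorem kappa_mul_K_sub_inv_pow_mul_K' {q : ℂ} (hq0 : q ≠ 0) {r : ℂ} (hr : r ^ 2 = q) (n : ℕ)
    {ε : ℂ} (hε : ε * ε = 1) (δ : ℂ) (i : ℕ) :
    (q⁻¹ - q)⁻¹ * (δ * r ^ ((n : ℤ) - 2 * (i : ℤ))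
      - ε * (q ^ n)⁻¹ * (ε * δ * r ^ (2 * (i : ℤ) - (n : ℤ)))) =
      -(δ * (r ^ n)⁻¹ * qint q ((n : ℤ) - i)) := by
  subst hr
  have hr0 : r ≠ 0 := by rintro rfl; simp at hq0
  have h₃ : (r ^ 2) ^ n = r ^ n * r ^ n := by ring
  have hn : r ^ n * (r ^ n)⁻¹ = 1 := mul_inv_cancel₀ (pow_ne_zero _ hr0)
  have h₄ : (r ^ 2 - (r ^ 2)⁻¹)⁻¹ = -((r ^ 2)⁻¹ - r ^ 2)⁻¹ := by rw [← inv_neg, neg_sub]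
  rw [zpow_natCast_sub_two_mul hr0, zpow_two_mul_sub_natCast hr0, h₃, qint, _root_.zpow_neg, zpow_sub₀ hq0, zpow_natCast, zpow_natCast, h₃, div_eq_mul_inv,
    h₄, inv_div, mul_inv]
  simp only [div_eq_mul_inv, mul_inv]
  linear_combination (-((r ^ 2)⁻¹ - r ^ 2)⁻¹ * δ * (r ^ 2) ^ i * ((r ^ n)⁻¹) ^ 3) * hε
    - (((r ^ 2)⁻¹ - r ^ 2)⁻¹ * δ * r ^ n * ((r ^ 2) ^ i)⁻¹) * hn

/-- The coordinates of the vector annihilated by `X` and `Y`. -/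
def annCoeff (q s t : ℂ) (n i : ℕ) : ℂ :=
  ∏ j ∈ Finset.range i, (-(s * qint q ((n : ℤ) - j)) / (t * qint q ((j + 1 : ℕ) : ℤ)))

theorem annCoeff_succ {q : ℂ} (hq0 : q ≠ 0) (hroot : ∀ m : ℕ, 0 < m → q ^ m ≠ 1) {t : ℂ}
    (ht : t ≠ 0) (s : ℂ) (n i : ℕ) :
    t * qint q ((i + 1 : ℕ) : ℤ) * annCoeff q s t n (i + 1) =
      -(s * qint q ((n : ℤ) - i)) * annCoeff q s t n i := by
  have h : qint q ((i + 1 : ℕ) : ℤ) ≠ 0 := qint_ne_zero hq0 hroot (by omega)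
  rw [annCoeff, Finset.prod_range_succ, ← annCoeff]
  field_simp

theorem annCoeff_ne_zero {q : ℂ} (hq0 : q ≠ 0) (hroot : ∀ m : ℕ, 0 < m → q ^ m ≠ 1) {s t : ℂ}
    (hs : s ≠ 0) (ht : t ≠ 0) {n i : ℕ} (hi : i ≤ n) : annCoeff q s t n i ≠ 0 := by
  refine Finset.prod_ne_zero_iff.mpr fun j hj => ?_
  have := Finset.mem_range.mp hj
  exact div_ne_zero (neg_ne_zero.mpr (mul_ne_zero hs (qint_ne_zero hq0 hroot (by omega))))
    (mul_ne_zero ht (qint_ne_zero hq0 hroot (by omega)))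

theorem ME_mulVec_apply (n : ℕ) (ε q : ℂ) (c : ℕ → ℂ) (j : Fin (n + 1)) :
    (ME n ε q *ᵥ fun i => c i.val) j =
      if j.val < n then ε * qint q ((j.val + 1 : ℕ) : ℤ) * c (j.val + 1) else 0 := by
  simp only [mulVec, dotProduct, ME, ite_mul, zero_mul]
  split_ifs with h
  · rw [Finset.sum_eq_single (⟨j.val + 1, by omega⟩ : Fin (n + 1))]
    · simp
    · intro b _ hb
      exact if_neg fun hb' => hb (Fin.ext hb')
    · simp
  · exact Finset.sum_eq_zero fun b _ => if_neg (by omega)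

theorem MF_mulVec_apply_zero (n : ℕ) (q : ℂ) (c : ℕ → ℂ) :
    (MF n q *ᵥ fun i => c i.val) 0 = 0 := by
  simp [mulVec, dotProduct, MF]

theorem MF_mulVec_apply_succ (n : ℕ) (q : ℂ) (c : ℕ → ℂ) (j : Fin n) :
    (MF n q *ᵥ fun i => c i.val) j.succ = qint q ((n : ℤ) - j.val) * c j.val := by
  simp only [mulVec, dotProduct, MF, ite_mul, zero_mul]
  rw [Finset.sum_eq_single j.castSucc]
  · simp
  · intro b _ hb
    refine if_neg fun hb' => hb (Fin.ext ?_)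
    simpa using hb'.symm
  · simp

theorem X_mulVec_annCoeff {q : ℂ} (hq0 : q ≠ 0) (hroot : ∀ m : ℕ, 0 < m → q ^ m ≠ 1)
    {r : ℂ} (hr : r ^ 2 = q) (n : ℕ) {ε δ : ℂ} (hε : ε * ε = 1) (hδ : δ * δ = ε)
    {s : ℂ} (hs : s ≠ 0) :
    ((q⁻¹ - q)⁻¹ • (MK n δ r - (ε * (q ^ n)⁻¹) • MK' n ε δ r) - s⁻¹ • ME n ε q).mulVec
      (fun i => annCoeff q s (δ * r ^ n) n i.val) = 0 := by
  have hr0 : r ≠ 0 := by rintro rfl; exact hq0 (by simp [← hr])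
  have hδ0 : δ ≠ 0 := by rintro rfl; simp [← hδ] at hε
  have ht : δ * r ^ n ≠ 0 := mul_ne_zero hδ0 (pow_ne_zero _ hr0)
  ext j
  have hX := kappa_mul_K_sub_inv_pow_mul_K' hq0 hr n hε δ j.val
  simp only [sub_mulVec, smul_mulVec, MK_eq_diagonal, MK'_eq_diagonal, Pi.sub_apply,
    Pi.smul_apply, smul_eq_mul, mulVec_diagonal, ME_mulVec_apply, Pi.zero_apply]
  split_ifs with hj
  · have hc := annCoeff_succ hq0 hroot ht s n j.val
    have hss : s⁻¹ * s = 1 := inv_mul_cancel₀ hs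
    have hrr : (r ^ n)⁻¹ * r ^ n = 1 := inv_mul_cancel₀ (pow_ne_zero _ hr0)
    set c := annCoeff q s (δ * r ^ n) n
    linear_combination c j.val * hX - (s⁻¹ * (r ^ n)⁻¹ * δ) * hc
      + (δ * (r ^ n)⁻¹ * qint q ((n : ℤ) - j.val) * c j.val) * hss
      + (s⁻¹ * (ε * qint q ((j.val + 1 : ℕ) : ℤ) * c (j.val + 1))) * hrr
      + (s⁻¹ * (r ^ n)⁻¹ * r ^ n * qint q ((j.val + 1 : ℕ) : ℤ) * c (j.val + 1)) * hδ
  · have hjn : (n : ℤ) - j.val = 0 := by omega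
    have hz : qint q 0 = 0 := by simp [qint]
    rw [hjn, hz] at hX
    linear_combination annCoeff q s (δ * r ^ n) n j.val * hX

theorem Y_mulVec_annCoeff {q : ℂ} (hq0 : q ≠ 0) (hroot : ∀ m : ℕ, 0 < m → q ^ m ≠ 1)
    {r : ℂ} (hr : r ^ 2 = q) (n : ℕ) {ε δ : ℂ} (hε : ε * ε = 1) (hδ0 : δ ≠ 0) (s : ℂ) :
    ((q⁻¹ - q)⁻¹ • (MK n δ r - (ε * q ^ n) • MK' n ε δ r) + s • MF n q).mulVec
      (fun i => annCoeff q s (δ * r ^ n) n i.val) = 0 := by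
  have hr0 : r ≠ 0 := by rintro rfl; exact hq0 (by simp [← hr])
  have ht : δ * r ^ n ≠ 0 := mul_ne_zero hδ0 (pow_ne_zero _ hr0)
  ext j
  have hY := kappa_mul_K_sub_pow_mul_K' hq0 hr n hε δ j.val
  simp only [sub_mulVec, add_mulVec, smul_mulVec, MK_eq_diagonal, MK'_eq_diagonal, Pi.sub_apply,
    Pi.add_apply, Pi.smul_apply, smul_eq_mul, mulVec_diagonal, Pi.zero_apply]
  induction j using Fin.cases with
  | zero =>
    have hz : qint q ((0 : ℕ) : ℤ) = 0 := by simp [qint]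
    rw [MF_mulVec_apply_zero]
    rw [Fin.val_zero, hz] at hY
    rw [Fin.val_zero]
    linear_combination annCoeff q s (δ * r ^ n) n 0 * hY
  | succ k =>
    rw [MF_mulVec_apply_succ]
    rw [Fin.val_succ] at hY ⊢
    linear_combination annCoeff q s (δ * r ^ n) n (k.val + 1) * hY
      + annCoeff_succ hq0 hroot ht s n k.val

/-- A representation of an algebra `A` on `ℂ^ι` with a cyclic vector annihilated by a set `T`
receives an `A`-equivariant surjection from `A / A T`. -/
theorem exists_surjective_of_cyclic {A ι : Type*} [Ring A] [Algebra ℂ A] [Fintype ι]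
    [DecidableEq ι] (ρ : A →ₐ[ℂ] Matrix ι ι ℂ) (T : Set A) (v : ι → ℂ)
    (hT : ∀ x ∈ T, ρ x *ᵥ v = 0) (hv : ∀ w, ∃ a, ρ a *ᵥ v = w) :
    ∃ ψ : (A ⧸ (Submodule.span A T : Submodule A A)) →ₗ[ℂ] (ι → ℂ),
      Function.Surjective ψ ∧ ∀ (a : A) (x), ψ (a • x) = (ρ a).mulVec (ψ x) := by
  let f : A →ₗ[ℂ] (ι → ℂ) := (mulVecBilin ℂ ℂ).flip v ∘ₗ ρ.toLinearMap
  have hf : ∀ a, f a = ρ a *ᵥ v := fun _ => rfl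
  have hker : (Submodule.span A T).restrictScalars ℂ ≤ LinearMap.ker f := by
    intro x hx
    rw [LinearMap.mem_ker, hf]
    induction (Submodule.restrictScalars_mem ℂ _ x).mp hx using Submodule.span_induction with
    | mem y hy => exact hT y hy
    | zero => simp
    | add y z hy hz ihy ihz => simp [add_mulVec, ihy hy, ihz hz]
    | smul a y hy ihy => rw [smul_eq_mul, map_mul, ← mulVec_mulVec, ihy hy, mulVec_zero]
  let ψ := ((Submodule.span A T).restrictScalars ℂ).liftQ f hker ∘ₗ
    (Submodule.Quotient.restrictScalarsEquiv ℂ (Submodule.span A T)).symm.toLinearMap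
  have hψ : ∀ a : A, ψ (Submodule.Quotient.mk a) = ρ a *ᵥ v := fun _ => rfl
  refine ⟨ψ, fun w => ?_, fun a x => ?_⟩
  · obtain ⟨a, ha⟩ := hv w
    exact ⟨Submodule.Quotient.mk a, ha⟩
  · obtain ⟨b, rfl⟩ := Submodule.Quotient.mk_surjective _ x
    rw [← Submodule.Quotient.mk_smul, hψ, hψ, smul_eq_mul, map_mul, mulVec_mulVec]

/-- `Ev₀ = (K ∓ qⁿK′)v₀ = 0` and `Fvₙ = (K ∓ q^{−n}K′)vₙ = 0`; for every `s ≠ 0` there is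
a nonzero `v ∈ V(n,±)` with `(κ(K ∓ q^{−n}K′) − s⁻¹E)v = 0` and `(κ(K ∓ qⁿK′) + sF)v = 0`;
consequently, setting `X = κ(K ∓ q^{−n}K′) − s⁻¹E` and `Y = κ(K ∓ qⁿK′) + sF` in `S`,
there is a surjective homomorphism of left `S`-modules `S/(SX + SY) → V(n,±)` (stated as a
surjective ℂ-linear map that is equivariant for the `S`-actions). -/
theorem stmt_16 (q : ℂ) (hq0 : q ≠ 0) (hroot : ∀ m : ℕ, 0 < m → q ^ m ≠ 1)
    (κ : ℂ) (hκ : κ = (q⁻¹ - q)⁻¹) (r : ℂ) (hr : r ^ 2 = q)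
    (n : ℕ) (ε δ : ℂ) (hsign : (ε = 1 ∧ δ = 1) ∨ (ε = -1 ∧ δ = Complex.I)) :
    -- `Ev₀ = 0` and `(K ∓ qⁿK′)v₀ = 0`
    (ME n ε q).mulVec (Pi.single (0 : Fin (n + 1)) 1) = 0
    ∧ (MK n δ r - (ε * q ^ n) • MK' n ε δ r).mulVec (Pi.single (0 : Fin (n + 1)) 1) = 0
    -- `Fvₙ = 0` and `(K ∓ q^{−n}K′)vₙ = 0`
    ∧ (MF n q).mulVec (Pi.single (Fin.last n) 1) = 0
    ∧ (MK n δ r - (ε * (q ^ n)⁻¹) • MK' n ε δ r).mulVec (Pi.single (Fin.last n) 1) = 0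
    -- for every `s ≠ 0`, a common nonzero annihilated vector
    ∧ (∀ s : ℂ, s ≠ 0 → ∃ v : Fin (n + 1) → ℂ, v ≠ 0 ∧
        (κ • (MK n δ r - (ε * (q ^ n)⁻¹) • MK' n ε δ r) - s⁻¹ • ME n ε q).mulVec v = 0 ∧
        (κ • (MK n δ r - (ε * q ^ n) • MK' n ε δ r) + s • MF n q).mulVec v = 0)
    -- consequently: a surjective homomorphism of left `S`-modules `S/(SX+SY) → V(n,±)`
    ∧ ∀ s : ℂ, s ≠ 0 →
        ∀ ρ : SAlg q →ₐ[ℂ] Matrix (Fin (n + 1)) (Fin (n + 1)) ℂ,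
        ρ (gE q) = ME n ε q → ρ (gF q) = MF n q →
        ρ (gK q) = MK n δ r → ρ (gK' q) = MK' n ε δ r →
        ∃ ψ : (SAlg q ⧸
            (Submodule.span (SAlg q)
              {κ • (gK q - (ε * (q ^ n)⁻¹) • gK' q) - s⁻¹ • gE q,
               κ • (gK q - (ε * q ^ n) • gK' q) + s • gF q} :
              Submodule (SAlg q) (SAlg q))) →ₗ[ℂ] (Fin (n + 1) → ℂ),
          Function.Surjective ψ ∧
          ∀ (a : SAlg q) (x), ψ (a • x) = (ρ a).mulVec (ψ x) := by
  have hε : ε * ε = 1 := by rcases hsign with ⟨rfl, -⟩ | ⟨rfl, -⟩ <;> norm_num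
  have hδ : δ * δ = ε := by rcases hsign with ⟨rfl, rfl⟩ | ⟨rfl, rfl⟩ <;> simp
  have hδ0 : δ ≠ 0 := by rintro rfl; simp [← hδ] at hε
  have hr0 : r ≠ 0 := by rintro rfl; exact hq0 (by simp [← hr])
  have ht : δ * r ^ n ≠ 0 := mul_ne_zero hδ0 (pow_ne_zero _ hr0)
  have hκ0 : (q⁻¹ - q)⁻¹ ≠ 0 := by
    rw [← neg_sub]
    exact inv_ne_zero (neg_ne_zero.mpr (q_sub_inv_ne_zero hq0 hroot))
  have hz : qint q 0 = 0 := by simp [qint]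
  subst hκ
  refine ⟨?_, ?_, ?_, ?_, fun s hs => ?_, fun s hs ρ hE hF hK hK' => ?_⟩
  · ext j
    simp [ME]
  · ext j
    simp only [MK_eq_diagonal, MK'_eq_diagonal, sub_mulVec, smul_mulVec, Pi.sub_apply,
      Pi.smul_apply, smul_eq_mul, mulVec_diagonal, Pi.zero_apply]
    by_cases hj : j = 0
    · subst hj
      have h := kappa_mul_K_sub_pow_mul_K' hq0 hr n hε δ 0
      rw [Nat.cast_zero, hz, mul_zero (δ * r ^ n)] at h
      have h' := (mul_eq_zero.mp h).resolve_left hκ0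
      simpa using h'
    · simp [hj]
  · ext j
    have := j.isLt
    simp [MF, this.ne]
  · ext j
    simp only [MK_eq_diagonal, MK'_eq_diagonal, sub_mulVec, smul_mulVec, Pi.sub_apply,
      Pi.smul_apply, smul_eq_mul, mulVec_diagonal, Pi.zero_apply]
    by_cases hj : j = Fin.last n
    · subst hj
      have h := kappa_mul_K_sub_inv_pow_mul_K' hq0 hr n hε δ n
      rw [sub_self, hz, mul_zero, neg_zero] at h
      simpa using (mul_eq_zero.mp h).resolve_left hκ0
    · simp [hj]
  · refine ⟨fun i => annCoeff q s (δ * r ^ n) n i.val, fun h => ?_,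
      X_mulVec_annCoeff hq0 hroot hr n hε hδ hs, Y_mulVec_annCoeff hq0 hroot hr n hε hδ0 s⟩
    exact annCoeff_ne_zero hq0 hroot hs ht (Nat.zero_le n) (congrFun h 0)
  · refine exists_surjective_of_cyclic ρ _ (fun i => annCoeff q s (δ * r ^ n) n i.val) ?_ ?_
    · rintro x (rfl | rfl)
      · simpa only [map_sub, map_smul, hE, hK, hK'] using
          X_mulVec_annCoeff hq0 hroot hr n hε hδ hs
      · simpa only [map_add, map_sub, map_smul, hF, hK, hK'] using
          Y_mulVec_annCoeff hq0 hroot hr n hε hδ0 s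
    · intro w
      obtain ⟨p, hp⟩ := exists_aeval_diagonal_mulVec_eq
        (K_eigenvalues_injective hq0 hroot hr n hδ0)
        (fun i : Fin (n + 1) =>
          annCoeff_ne_zero hq0 hroot hs ht (Nat.lt_succ_iff.mp i.isLt)) w
      refine ⟨Polynomial.aeval (gK q) p, ?_⟩
      rw [← Polynomial.aeval_algHom_apply, hK, MK_eq_diagonal, hp]
end
end

section
/- Let n ≥ 0 be an integer, fix a sign ±, and let s ∈ ℂ ∖ {0}. Set X = κ(1 ∓ q^{n+2}k⁻¹) − s⁻¹r⁻¹e and Y = κ(k ∓ q^{−(n+2)}) + s r⁻¹ f in U. Then the cyclic left U-module U/(UX + UY) is simple. -/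
noncomputable section

open FreeAlgebra

/-- The defining relations of `U = U_q(sl₂)`.
Generators: `0 ↦ e`, `1 ↦ f`, `2 ↦ k`, `3 ↦ k⁻¹`. Relations: `kk⁻¹ = k⁻¹k = 1`,
`ke = q²ek`, `kf = q⁻²fk`, `(q − q⁻¹)(ef − fe) = k − k⁻¹`. -/
inductive URel (q : ℂ) : FreeAlgebra ℂ (Fin 4) → FreeAlgebra ℂ (Fin 4) → Prop
  | kki : URel q (ι ℂ 2 * ι ℂ 3) 1
  | kik : URel q (ι ℂ 3 * ι ℂ 2) 1
  | ke : URel q (ι ℂ 2 * ι ℂ 0) ((q ^ 2) • (ι ℂ 0 * ι ℂ 2))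
  | kf : URel q (ι ℂ 2 * ι ℂ 1) ((q ^ 2)⁻¹ • (ι ℂ 1 * ι ℂ 2))
  | ef : URel q ((q - q⁻¹) • (ι ℂ 0 * ι ℂ 1 - ι ℂ 1 * ι ℂ 0)) (ι ℂ 2 - ι ℂ 3)

/-- The quantized enveloping algebra `U_q(sl₂)`. -/
abbrev UAlg (q : ℂ) : Type := RingQuot (URel q)

def ue (q : ℂ) : UAlg q := RingQuot.mkAlgHom ℂ (URel q) (ι ℂ 0)
def uf (q : ℂ) : UAlg q := RingQuot.mkAlgHom ℂ (URel q) (ι ℂ 1)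
def uk (q : ℂ) : UAlg q := RingQuot.mkAlgHom ℂ (URel q) (ι ℂ 2)
def uki (q : ℂ) : UAlg q := RingQuot.mkAlgHom ℂ (URel q) (ι ℂ 3)

namespace UAlg

open Polynomial

section Relations

variable (q : ℂ)

lemma uk_mul_uki : uk q * uki q = 1 := by
  simpa [uk, uki] using RingQuot.mkAlgHom_rel ℂ (URel.kki (q := q))

lemma uki_mul_uk : uki q * uk q = 1 := by
  simpa [uk, uki] using RingQuot.mkAlgHom_rel ℂ (URel.kik (q := q))

lemma uk_mul_ue : uk q * ue q = q ^ 2 • (ue q * uk q) := by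
  simpa [uk, ue] using RingQuot.mkAlgHom_rel ℂ (URel.ke (q := q))

lemma uk_mul_uf : uk q * uf q = (q ^ 2)⁻¹ • (uf q * uk q) := by
  simpa [uk, uf] using RingQuot.mkAlgHom_rel ℂ (URel.kf (q := q))

variable {q}

lemma pow_mul_of_mul_eq_smul {A : Type*} [Ring A] [Algebra ℂ A] {x y : A} {c : ℂ}
    (h : x * y = c • (y * x)) (m : ℕ) : x ^ m * y = c ^ m • (y * x ^ m) := by
  induction m with
  | zero => simp
  | succ m ih =>
    rw [pow_succ, mul_assoc, h, mul_smul_comm, ← mul_assoc, ih, smul_mul_assoc, smul_smul,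
      mul_assoc, pow_succ' c]

lemma pow_mul_mul_sub_aeval_eq_smul {A : Type*} [Ring A] [Algebra ℂ A] {x y : A} {c : ℂ}
    (h : x * y = c • (y * x)) (m : ℕ) (u w : A) (p : ℂ[X]) :
    x ^ m * (y * u) - aeval x (C (c ^ m) * p) =
      c ^ m • (y * (x ^ m * u - w) + (y * w - aeval x p)) := by
  rw [← mul_assoc (x ^ m), pow_mul_of_mul_eq_smul h, map_mul, aeval_C, ← Algebra.smul_def,
    smul_mul_assoc, ← smul_sub, mul_sub, mul_assoc, sub_add_sub_cancel]

lemma pow_succ_mul_mul_sub_aeval_eq_smul {A : Type*} [Ring A] [Algebra ℂ A] {x y : A} {c : ℂ}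
    (h : x * y = c • (y * x)) (m : ℕ) (u w : A) (p : ℂ[X]) :
    x ^ (m + 1) * (y * u) - aeval x (C (c ^ m) * p) =
      c ^ m • (x * y * (x ^ m * u - w) + (x * (y * w) - aeval x p)) := by
  rw [pow_succ', mul_assoc x, ← mul_assoc (x ^ m), pow_mul_of_mul_eq_smul h, map_mul, aeval_C,
    ← Algebra.smul_def, smul_mul_assoc, mul_smul_comm, ← smul_sub, mul_sub, mul_assoc x,
    mul_assoc x, mul_assoc y, sub_add_sub_cancel]

/-- If `y x = c x y` then `y p(x) = p(c x) y` for every polynomial `p`. -/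
lemma mul_aeval_of_mul_eq_smul {A : Type*} [Ring A] [Algebra ℂ A] {x y : A} {c : ℂ}
    (h : y * x = c • (x * y)) (p : ℂ[X]) :
    y * aeval x p = aeval x (p.comp (C c * X)) * y := by
  have hpow (n : ℕ) : y * x ^ n = (c • x) ^ n * y := by
    have : SemiconjBy y x (c • x) := by rw [SemiconjBy, h, smul_mul_assoc]
    exact this.pow_right n
  have hc : aeval x (C c * X : ℂ[X]) = c • x := by simp [Algebra.smul_def]
  rw [aeval_comp, hc]
  induction p using Polynomial.induction_on' with
  | add p₁ p₂ h₁ h₂ => rw [map_add, map_add, mul_add, add_mul, h₁, h₂]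
  | monomial n a =>
    rw [aeval_monomial, aeval_monomial, ← mul_assoc, ← Algebra.commutes a y, mul_assoc, hpow,
      mul_assoc]

lemma ue_mul_aeval (hq : q ≠ 0) (p : ℂ[X]) :
    ue q * aeval (uk q) p = aeval (uk q) (p.comp (C (q ^ 2)⁻¹ * X)) * ue q := by
  refine mul_aeval_of_mul_eq_smul ?_ p
  rw [uk_mul_ue, smul_smul, inv_mul_cancel₀ (pow_ne_zero 2 hq), one_smul]

lemma uf_mul_aeval (hq : q ≠ 0) (p : ℂ[X]) :
    uf q * aeval (uk q) p = aeval (uk q) (p.comp (C (q ^ 2) * X)) * uf q := by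
  refine mul_aeval_of_mul_eq_smul ?_ p
  rw [uk_mul_uf, smul_smul, mul_inv_cancel₀ (pow_ne_zero 2 hq), one_smul]

end Relations

/-- A `ℂ`-subspace of `U` that contains `1` and is stable under left multiplication by the
generators is everything. -/
lemma mem_of_generators_mul_mem {q : ℂ} (W : Submodule ℂ (UAlg q)) (h1 : (1 : UAlg q) ∈ W)
    (he : ∀ u ∈ W, ue q * u ∈ W) (hf : ∀ u ∈ W, uf q * u ∈ W)
    (hk : ∀ u ∈ W, uk q * u ∈ W) (hki : ∀ u ∈ W, uki q * u ∈ W) (u : UAlg q) : u ∈ W := by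
  obtain ⟨x, rfl⟩ := RingQuot.mkAlgHom_surjective ℂ (URel q) u
  suffices h : ∀ u ∈ W, RingQuot.mkAlgHom ℂ (URel q) x * u ∈ W by simpa using h 1 h1
  induction x using FreeAlgebra.induction with
  | grade0 c =>
    intro u hu
    rw [AlgHom.commutes, ← Algebra.smul_def]
    exact W.smul_mem c hu
  | grade1 i =>
    fin_cases i
    · exact he
    · exact hf
    · exact hk
    · exact hki
  | mul a b ha hb =>
    intro u hu
    rw [map_mul, mul_assoc]
    exact ha _ (hb _ hu)
  | add a b ha hb =>
    intro u hu
    rw [map_add, add_mul]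
    exact W.add_mem (ha _ hu) (hb _ hu)

section LeftIdeal

variable {q : ℂ} {N : Submodule (UAlg q) (UAlg q)} {g h : ℂ[X]}

/-- `k e ≡ g(k)` modulo a left ideal gives `k e p(k) ≡ (p(q⁻² X) g)(k)`. -/
lemma uk_mul_ue_mul_aeval_sub_mem (hq : q ≠ 0) (hg : uk q * ue q - aeval (uk q) g ∈ N) (p : ℂ[X]) :
    uk q * (ue q * aeval (uk q) p) - aeval (uk q) (p.comp (C (q ^ 2)⁻¹ * X) * g) ∈ N := by
  have hcomm : uk q * aeval (uk q) (p.comp (C (q ^ 2)⁻¹ * X)) =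
      aeval (uk q) (p.comp (C (q ^ 2)⁻¹ * X)) * uk q := by
    simpa using congrArg (aeval (uk q)) (mul_comm X (p.comp (C (q ^ 2)⁻¹ * X)))
  rw [ue_mul_aeval hq, map_mul, ← mul_assoc, hcomm, mul_assoc, ← mul_sub]
  exact N.smul_mem _ hg

/-- `f ≡ h(k)` modulo a left ideal gives `f p(k) ≡ (p(q² X) h)(k)`. -/
lemma uf_mul_aeval_sub_mem (hq : q ≠ 0) (hh : uf q - aeval (uk q) h ∈ N) (p : ℂ[X]) :
    uf q * aeval (uk q) p - aeval (uk q) (p.comp (C (q ^ 2) * X) * h) ∈ N := by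
  rw [uf_mul_aeval hq, map_mul, ← mul_sub]
  exact N.smul_mem _ hh

/-- If `k e` and `f` are congruent to polynomials in `k` modulo a left ideal, then every element
of `U` is so after multiplication by a power of `k`. -/
lemma exists_uk_pow_mul_sub_aeval_mem (hq : q ≠ 0) (hg : uk q * ue q - aeval (uk q) g ∈ N)
    (hh : uf q - aeval (uk q) h ∈ N) (u : UAlg q) :
    ∃ (m : ℕ) (p : ℂ[X]), uk q ^ m * u - aeval (uk q) p ∈ N := by
  have hmul (x : UAlg q) {y : UAlg q} (hy : y ∈ N) : x * y ∈ N := N.smul_mem x hy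
  let W : Submodule ℂ (UAlg q) :=
    { carrier := {u | ∃ (m : ℕ) (p : ℂ[X]), uk q ^ m * u - aeval (uk q) p ∈ N}
      zero_mem' := ⟨0, 0, by simp⟩
      add_mem' := by
        rintro u v ⟨m, p, hp⟩ ⟨l, p', hp'⟩
        refine ⟨m + l, X ^ l * p + X ^ m * p', ?_⟩
        convert N.add_mem (hmul (uk q ^ l) hp) (hmul (uk q ^ m) hp') using 1
        simp only [map_add, map_mul, map_pow, aeval_X, mul_sub, mul_add, ← mul_assoc, ← pow_add,
          add_comm l m]
        abel
      smul_mem' := by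
        rintro c u ⟨m, p, hp⟩
        refine ⟨m, c • p, ?_⟩
        rw [mul_smul_comm, map_smul, ← smul_sub]
        exact N.smul_of_tower_mem c hp }
  refine mem_of_generators_mul_mem W ⟨0, 1, by simp⟩ ?_ ?_ ?_ ?_ u
  · rintro u ⟨m, p, hp⟩
    refine ⟨m + 1, C ((q ^ 2) ^ m) * (p.comp (C (q ^ 2)⁻¹ * X) * g), ?_⟩
    convert N.smul_of_tower_mem ((q ^ 2) ^ m)
      (N.add_mem (hmul (uk q * ue q) hp) (uk_mul_ue_mul_aeval_sub_mem hq hg p)) using 1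
    exact pow_succ_mul_mul_sub_aeval_eq_smul (uk_mul_ue q) m _ _ _
  · rintro u ⟨m, p, hp⟩
    refine ⟨m, C (((q ^ 2)⁻¹) ^ m) * (p.comp (C (q ^ 2) * X) * h), ?_⟩
    convert N.smul_of_tower_mem (((q ^ 2)⁻¹) ^ m)
      (N.add_mem (hmul (uf q) hp) (uf_mul_aeval_sub_mem hq hh p)) using 1
    exact pow_mul_mul_sub_aeval_eq_smul (uk_mul_uf q) m _ _ _
  · rintro u ⟨m, p, hp⟩
    refine ⟨m, X * p, ?_⟩
    convert hmul (uk q) hp using 1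
    rw [map_mul, aeval_X, mul_sub, ← mul_assoc, ← mul_assoc, ← pow_succ, pow_succ']
  · rintro u ⟨m, p, hp⟩
    refine ⟨m + 1, p, ?_⟩
    rwa [pow_succ, mul_assoc, ← mul_assoc (uk q), uk_mul_uki, one_mul]

end LeftIdeal

/-- A nonzero polynomial whose nonzero roots propagate along `x ↦ c x` until they reach `a`, with
`c` not a root of unity, has all its nonzero roots on the backward orbit of `a`. -/
lemma exists_pow_mul_eq_of_isRoot {g : ℂ[X]} (hg : g ≠ 0) {c a : ℂ} (hc0 : c ≠ 0)
    (hc : ∀ n : ℕ, 0 < n → c ^ n ≠ 1) (hstep : ∀ x, g.IsRoot x → g.IsRoot (c * x) ∨ x = a)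
    {x : ℂ} (hx0 : x ≠ 0) (hx : g.IsRoot x) : ∃ j : ℕ, c ^ j * x = a := by
  by_contra! hne
  have hroots (j : ℕ) : g.IsRoot (c ^ j * x) := by
    induction j with
    | zero => simpa using hx
    | succ j ih =>
      rw [pow_succ', mul_assoc]
      exact (hstep _ ih).resolve_right (hne j)
  have hinj : Function.Injective fun j : ℕ => c ^ j * x := by
    have hlt {i j : ℕ} (hij : i < j) : c ^ i * x ≠ c ^ j * x := by
      intro h
      have h' := mul_right_cancel₀ hx0 h
      rw [← Nat.add_sub_cancel' hij.le, pow_add] at h'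
      exact hc (j - i) (by omega) (mul_left_cancel₀ (pow_ne_zero i hc0) (by rw [← h', mul_one]))
    intro i j hij
    rcases lt_trichotomy i j with h | h | h
    · exact absurd hij (hlt h)
    · exact h
    · exact absurd hij.symm (hlt h)
  exact Set.infinite_of_injective_forall_mem hinj hroots (finite_setOfPred_isRoot hg)

/-- An ideal of `ℂ[X]` that is nonzero, saturated with respect to `X` and stable under
`p ↦ p(t⁻¹ X)(X - a)` and `p ↦ p(t X)(X - b)` is the unit ideal, if `t` is not a root of unity and
`b` is not of the form `t ^ m a`, `m ≥ 0`. -/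
lemma ideal_eq_top_of_twist_stable {I : Ideal ℂ[X]} (hI : I ≠ ⊥) (hX : ∀ p, X * p ∈ I → p ∈ I)
    {t a b : ℂ} (ht0 : t ≠ 0) (ht : ∀ n : ℕ, 0 < n → t ^ n ≠ 1) (hab : ∀ m : ℕ, t ^ m * a ≠ b)
    (ha : ∀ p ∈ I, p.comp (C t⁻¹ * X) * (X - C a) ∈ I)
    (hb : ∀ p ∈ I, p.comp (C t * X) * (X - C b) ∈ I) : I = ⊤ := by
  obtain ⟨g, hgI⟩ : ∃ g, I = Ideal.span {g} :=
    (IsPrincipalIdealRing.principal I).principal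
  have hg : g ≠ 0 := by
    rintro rfl
    exact hI (by simpa using hgI)
  have hdvd {p : ℂ[X]} : p ∈ I ↔ g ∣ p := by rw [hgI, Ideal.mem_span_singleton]
  rw [hgI, Ideal.span_singleton_eq_top]
  by_contra hunit
  have hdeg : g.degree ≠ 0 := fun h => hunit (isUnit_iff_degree_eq_zero.2 h)
  obtain ⟨x, hx⟩ := IsAlgClosed.exists_root g hdeg
  have hx0 : x ≠ 0 := by
    rintro rfl
    obtain ⟨p, rfl⟩ : X ∣ g := by simpa using dvd_iff_isRoot.2 hx
    obtain ⟨c, hc⟩ := hdvd.1 (hX p (hdvd.2 dvd_rfl))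
    have hp : p ≠ 0 := right_ne_zero_of_mul hg
    have h1 : X * c = 1 := mul_left_cancel₀ hp (by linear_combination -hc)
    simpa using congrArg (eval 0) h1
  have hstepa (y : ℂ) (hy : g.IsRoot y) : g.IsRoot (t⁻¹ * y) ∨ y = a := by
    have h := hy.dvd (hdvd.1 (ha g (hdvd.2 dvd_rfl)))
    simpa [IsRoot, sub_eq_zero] using h
  have hstepb (y : ℂ) (hy : g.IsRoot y) : g.IsRoot (t * y) ∨ y = b := by
    have h := hy.dvd (hdvd.1 (hb g (hdvd.2 dvd_rfl)))
    simpa [IsRoot, sub_eq_zero] using h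
  obtain ⟨j, hj⟩ := exists_pow_mul_eq_of_isRoot hg (inv_ne_zero ht0)
    (fun n hn h => ht n hn (by simpa using h)) hstepa hx0 hx
  obtain ⟨l, hl⟩ := exists_pow_mul_eq_of_isRoot hg ht0 ht hstepb hx0 hx
  refine hab (l + j) ?_
  rw [← hj, ← hl, inv_pow, pow_add, mul_assoc, mul_inv_cancel_left₀ (pow_ne_zero j ht0)]

/-- A left ideal properly containing one modulo which `k e ≡ α (k - a)` and `f ≡ β (k - b)` is
everything, provided `b` is not of the form `q ^ (2 m) a`, `m ≥ 0`. -/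
lemma eq_top_of_lt {q : ℂ} (hq : q ≠ 0) (hroot : ∀ n : ℕ, 0 < n → q ^ n ≠ 1)
    {J N : Submodule (UAlg q) (UAlg q)} {α β a b : ℂ} (hα : α ≠ 0) (hβ : β ≠ 0)
    (hab : ∀ m : ℕ, (q ^ 2) ^ m * a ≠ b)
    (he : uk q * ue q - aeval (uk q) (C α * (X - C a)) ∈ J)
    (hf : uf q - aeval (uk q) (C β * (X - C b)) ∈ J) (hJN : J < N) : N = ⊤ := by
  have hmul (x : UAlg q) {y : UAlg q} (hy : y ∈ N) : x * y ∈ N := N.smul_mem x hy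
  let I : Ideal ℂ[X] :=
    { carrier := {p | aeval (uk q) p ∈ N}
      zero_mem' := by simp
      add_mem' := fun {p p'} hp hp' => by
        rw [Set.mem_ofPred_eq, map_add]
        exact N.add_mem hp hp'
      smul_mem' := fun c p hp => by
        rw [Set.mem_ofPred_eq, smul_eq_mul, map_mul]
        exact hmul _ hp }
  have mem_I {p : ℂ[X]} : p ∈ I ↔ aeval (uk q) p ∈ N := Iff.rfl
  have cancel_C {γ : ℂ} (hγ : γ ≠ 0) {p p' : ℂ[X]} (h : p * (C γ * p') ∈ I) : p * p' ∈ I := by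
    have h' := I.mul_mem_left (C γ⁻¹) h
    rwa [mul_left_comm p, ← mul_assoc, ← C_mul, inv_mul_cancel₀ hγ, C_1, one_mul] at h'
  have hI : I ≠ ⊥ := by
    obtain ⟨u, huN, huJ⟩ := SetLike.exists_of_lt hJN
    obtain ⟨m, p, hp⟩ := exists_uk_pow_mul_sub_aeval_mem hq he hf u
    have hpI : p ∈ I := by
      rw [mem_I, ← sub_sub_cancel (uk q ^ m * u) (aeval (uk q) p)]
      exact N.sub_mem (hmul _ huN) (hJN.le hp)
    intro hbot
    rw [hbot, Ideal.mem_bot] at hpI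
    rw [hpI, map_zero, sub_zero] at hp
    have hu : uki q ^ m * (uk q ^ m * u) = u := by
      have hc : Commute (uki q) (uk q) := (uki_mul_uk q).trans (uk_mul_uki q).symm
      rw [← mul_assoc, ← hc.mul_pow, uki_mul_uk, one_pow, one_mul]
    exact huJ (hu ▸ J.smul_mem (uki q ^ m) hp)
  have hX (p : ℂ[X]) (hp : X * p ∈ I) : p ∈ I := by
    rw [mem_I, map_mul, aeval_X] at hp
    have h := hmul (uki q) hp
    rwa [← mul_assoc, uki_mul_uk, one_mul] at h
  have htop : I = ⊤ := by
    refine ideal_eq_top_of_twist_stable hI hX (pow_ne_zero 2 hq)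
      (fun n hn h => hroot (2 * n) (by omega) (by rw [pow_mul, h])) hab ?_ ?_
    · intro p hp
      refine cancel_C hα (mem_I.2 ?_)
      rw [← sub_sub_cancel (uk q * (ue q * aeval (uk q) p)) (aeval (uk q) _)]
      exact N.sub_mem (hmul _ (hmul _ hp)) (hJN.le (uk_mul_ue_mul_aeval_sub_mem hq he p))
    · intro p hp
      refine cancel_C hβ (mem_I.2 ?_)
      rw [← sub_sub_cancel (uf q * aeval (uk q) p) (aeval (uk q) _)]
      exact N.sub_mem (hmul _ hp) (hJN.le (uf_mul_aeval_sub_mem hq hf p))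
  have h1 : (1 : UAlg q) ∈ N := by
    simpa using mem_I.1 ((Ideal.eq_top_iff_one I).1 htop)
  exact eq_top_iff.2 fun u _ => by simpa using hmul u h1

section Generators

variable {A : Type*} [Ring A] [Algebra ℂ A] {s r : ℂ}

lemma mul_sub_aeval_eq_smul {e k ki : A} (hk : k * ki = 1) (hs : s ≠ 0) (hr : r ≠ 0) (κ a : ℂ) :
    k * e - aeval k (C (s * r * κ) * (X - C a)) =
      -(s * r) • (k • (κ • ((1 : A) - a • ki) - (s⁻¹ * r⁻¹) • e)) := by
  simp only [map_mul, map_sub, aeval_X, aeval_C, Algebra.algebraMap_eq_smul_one, smul_eq_mul,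
    mul_sub, mul_smul_comm, smul_mul_assoc, one_mul, mul_one, hk]
  match_scalars <;> field_simp

lemma sub_aeval_eq_smul {f k : A} (hs : s ≠ 0) (hr : r ≠ 0) (κ b : ℂ) :
    f - aeval k (C (-(s⁻¹ * r * κ)) * (X - C b)) =
      (s⁻¹ * r) • (κ • (k - b • (1 : A)) + (s * r⁻¹) • f) := by
  simp only [map_mul, map_sub, aeval_X, aeval_C, Algebra.algebraMap_eq_smul_one,
    smul_mul_assoc, one_mul]
  match_scalars <;> field_simp

end Generators

/-- The action of `U` on functions on `{q ^ (2 i)}`, indexed by `i : ℤ`, in which `k` is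
multiplication by the coordinate and `e`, `f` are weighted shifts. -/
lemma exists_shift_representation {q : ℂ} (hq : q ≠ 0) {α β a b : ℂ} (hab : a * b = 1)
    (hαβ : (q - q⁻¹) * (α * β * ((q ^ 2)⁻¹ - 1)) = 1) :
    ∃ ρ : UAlg q →ₐ[ℂ] Module.End ℂ (ℤ → ℂ), ∀ (φ : ℤ → ℂ) (i : ℤ),
      ρ (ue q) φ i = α * (1 - a * ((q ^ 2) ^ i)⁻¹) * φ (i - 1) ∧
      ρ (uf q) φ i = β * ((q ^ 2) ^ i - b) * φ (i + 1) ∧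
      ρ (uk q) φ i = (q ^ 2) ^ i * φ i ∧
      ρ (uki q) φ i = ((q ^ 2) ^ i)⁻¹ * φ i := by
  let shift (w : ℤ → ℂ) (d : ℤ) : Module.End ℂ (ℤ → ℂ) :=
    { toFun := fun φ i => w i * φ (i + d)
      map_add' := fun φ ψ => by
        ext i
        simp [mul_add]
      map_smul' := fun c φ => by
        ext i
        simp [mul_left_comm] }
  have shift_apply (w d φ i) : shift w d φ i = w i * φ (i + d) := rfl
  let gens : Fin 4 → Module.End ℂ (ℤ → ℂ) :=
    ![shift (fun i => α * (1 - a * ((q ^ 2) ^ i)⁻¹)) (-1), shift (fun i => β * ((q ^ 2) ^ i - b)) 1,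
      shift (fun i => (q ^ 2) ^ i) 0, shift (fun i => ((q ^ 2) ^ i)⁻¹) 0]
  have ht : q ^ 2 ≠ 0 := pow_ne_zero 2 hq
  have hrel ⦃x y : FreeAlgebra ℂ (Fin 4)⦄ (hxy : URel q x y) :
      FreeAlgebra.lift ℂ gens x = FreeAlgebra.lift ℂ gens y := by
    ext1 φ
    ext i
    have hz : (q ^ 2) ^ i ≠ 0 := zpow_ne_zero i ht
    cases hxy with
    | kki => simp [gens, shift_apply, hz]
    | kik => simp [gens, shift_apply, hz]
    | ke =>
      simp only [gens, map_mul, map_smul, FreeAlgebra.lift_ι_apply, Module.End.mul_apply,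
        LinearMap.smul_apply, Pi.smul_apply, smul_eq_mul, shift_apply, Matrix.cons_val, add_zero,
        zpow_add₀ ht, zpow_neg_one]
      field_simp
    | kf =>
      simp only [gens, map_mul, map_smul, FreeAlgebra.lift_ι_apply, Module.End.mul_apply,
        LinearMap.smul_apply, Pi.smul_apply, smul_eq_mul, shift_apply, Matrix.cons_val, add_zero,
        zpow_add₀ ht, zpow_one]
      field_simp
    | ef =>
      simp only [gens, map_mul, map_smul, map_sub, FreeAlgebra.lift_ι_apply, Module.End.mul_apply,
        LinearMap.smul_apply, LinearMap.sub_apply, Pi.smul_apply, Pi.sub_apply, smul_eq_mul,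
        shift_apply, Matrix.cons_val, add_zero, neg_add_cancel_right, add_neg_cancel_right,
        zpow_add₀ ht, zpow_one, zpow_neg_one, mul_inv]
      generalize (q ^ 2) ^ i = z at hz
      generalize (q ^ 2)⁻¹ = τ at hαβ
      have hz' : z * z⁻¹ = 1 := mul_inv_cancel₀ hz
      generalize z⁻¹ = w at hz'
      linear_combination (z - w) * φ i * hαβ - (q - q⁻¹) * α * β * w * (τ - 1) * φ i * hab
  refine ⟨RingQuot.liftAlgHom ℂ ⟨FreeAlgebra.lift ℂ gens, hrel⟩, fun φ i => ?_⟩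
  simp [ue, uf, uk, uki, gens, shift_apply, sub_eq_add_neg]

end UAlg

/-- For `X = κ(1 ∓ q^{n+2}k⁻¹) − s⁻¹r⁻¹e` and `Y = κ(k ∓ q^{−(n+2)}) + sr⁻¹f` (with the
sign `±` encoded by `ε = ±1`), the cyclic left `U`-module `U/(UX + UY)` is simple. -/
theorem stmt_17 (q : ℂ) (hq0 : q ≠ 0) (hroot : ∀ n : ℕ, 0 < n → q ^ n ≠ 1)
    (hqi : q ≠ Complex.I) (hqni : q ≠ -Complex.I)
    (r : ℂ) (hr : r ^ 2 = q) (κ : ℂ) (hκ : κ = (q⁻¹ - q)⁻¹)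
    (n : ℕ) (ε : ℂ) (hε : ε = 1 ∨ ε = -1) (s : ℂ) (hs : s ≠ 0) :
    IsSimpleModule (UAlg q)
      ((UAlg q) ⧸
        (Submodule.span (UAlg q)
          {κ • ((1 : UAlg q) - (ε * q ^ (n + 2)) • uki q) - (s⁻¹ * r⁻¹) • ue q,
           κ • (uk q - (ε * (q ^ (n + 2))⁻¹) • (1 : UAlg q)) + (s * r⁻¹) • uf q} :
          Submodule (UAlg q) (UAlg q))) := by
  have hr0 : r ≠ 0 := by
    rintro rfl
    exact hq0 (by simpa using hr.symm)
  have hε2 : ε * ε = 1 := by rcases hε with rfl | rfl <;> norm_num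
  have hqq : q⁻¹ - q ≠ 0 := by
    intro h
    refine hroot 2 two_pos ?_
    field_simp at h
    linear_combination -h
  have hκ0 : κ ≠ 0 := hκ ▸ inv_ne_zero hqq
  have hQ : q ^ (n + 2) ≠ 0 := pow_ne_zero _ hq0
  rw [isSimpleModule_iff_isCoatom]
  refine ⟨?_, fun N hN => UAlg.eq_top_of_lt hq0 hroot (α := s * r * κ) (β := -(s⁻¹ * r * κ))
    (a := ε * q ^ (n + 2)) (b := ε * (q ^ (n + 2))⁻¹)
    (by positivity) (by simp [hs, hr0, hκ0]) ?_ ?_ ?_ hN⟩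
  · have hab : ε * q ^ (n + 2) * (ε * (q ^ (n + 2))⁻¹) = 1 := by
      rw [mul_mul_mul_comm, hε2, mul_inv_cancel₀ hQ, one_mul]
    have hαβ : (q - q⁻¹) * (s * r * κ * -(s⁻¹ * r * κ) * ((q ^ 2)⁻¹ - 1)) = 1 := by
      have hκ1 : κ * (q⁻¹ - q) = 1 := hκ ▸ inv_mul_cancel₀ hqq
      have hs1 : s * s⁻¹ = 1 := mul_inv_cancel₀ hs
      have hq1 : q * ((q ^ 2)⁻¹ - 1) = q⁻¹ - q := by field_simp
      linear_combination (q⁻¹ - q) * κ ^ 2 * r ^ 2 * ((q ^ 2)⁻¹ - 1) * hs1 +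
        (q⁻¹ - q) * κ ^ 2 * ((q ^ 2)⁻¹ - 1) * hr + (q⁻¹ - q) * κ ^ 2 * hq1 +
        (κ * (q⁻¹ - q) + 1) * hκ1
    obtain ⟨ρ, hρ⟩ := UAlg.exists_shift_representation hq0 hab hαβ
    intro htop
    have hkill (u : UAlg q) (hu : u ∈ (⊤ : Submodule (UAlg q) (UAlg q))) : ρ u 1 = 0 := by
      rw [← htop] at hu
      induction hu using Submodule.span_induction with
      | zero => simp
      | add x y _ _ hx hy => rw [map_add, LinearMap.add_apply, hx, hy, add_zero]
      | smul c x _ hx => rw [smul_eq_mul, map_mul, Module.End.mul_apply, hx, map_zero]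
      | mem x hx =>
        ext i
        rcases hx with rfl | rfl
        · simp only [map_sub, map_smul, map_one, LinearMap.sub_apply,
            LinearMap.smul_apply, Pi.sub_apply, Pi.smul_apply, Module.End.one_apply,
            hρ, smul_eq_mul, Pi.one_apply, Pi.zero_apply]
          field_simp
          ring
        · simp only [map_add, map_sub, map_smul, map_one, LinearMap.add_apply, LinearMap.sub_apply,
            LinearMap.smul_apply, Pi.add_apply, Pi.sub_apply, Pi.smul_apply, Module.End.one_apply,
            hρ, smul_eq_mul, Pi.one_apply, Pi.zero_apply]
          field_simp
          ring
    simpa using congrFun (hkill 1 trivial) 0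
  · intro m h
    have hε0 : ε ≠ 0 := left_ne_zero_of_mul_eq_one hε2
    refine hroot (2 * m + 2 * (n + 2)) (by omega) ?_
    rw [mul_left_comm] at h
    have h' := mul_left_cancel₀ hε0 h
    calc q ^ (2 * m + 2 * (n + 2)) = (q ^ 2) ^ m * q ^ (n + 2) * q ^ (n + 2) := by ring
      _ = 1 := by rw [h', inv_mul_cancel₀ hQ]
  · rw [UAlg.mul_sub_aeval_eq_smul (UAlg.uk_mul_uki q) hs hr0]
    exact Submodule.smul_of_tower_mem _ _
      (Submodule.smul_mem _ (uk q) (Submodule.subset_span (Set.mem_insert _ _)))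
  · rw [UAlg.sub_aeval_eq_smul hs hr0]
    exact Submodule.smul_of_tower_mem _ _
      (Submodule.subset_span (Set.mem_insert_of_mem _ (Set.mem_singleton _)))
end
end

section
/- Let b ∈ ℂ with b ∉ {0, i, −i}, set q = (1−ib)/(1+ib) and κ = 1/(q⁻¹ − q). For (x₀, x₁, x₂, x₃) ∈ ℂ⁴ define E = (i/2)(1−ib)(x₂+ix₃), F = (i/2)(1+ib)(x₂−ix₃), K = x₀+bx₁, K′ = x₀−bx₁. Then x₀² + x₁² + x₂² + x₃² = 0 and x₃² + (1+b²)x₁² + x₂² = 0 hold simultaneously if and only if either (K′ = 0 and EF + κ²K² = 0) or (K = 0 and EF + κ²K′² = 0). (The degenerate limit E_dg of the elliptic curves parametrizing points of the nondegenerate Sklyanin algebras equals the union C ∪ C′ of the two conics in the point scheme of S.) -/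
noncomputable section

open Complex

/-- `κ² = -(1 + b²)² / (16 b²)`, with denominators cleared. -/
lemma kappa_sq_mul (b : ℂ) (hb0 : b ≠ 0) (hp : 1 + I * b ≠ 0) (hm : 1 - I * b ≠ 0) :
    ((((1 - I * b) / (1 + I * b))⁻¹ - (1 - I * b) / (1 + I * b))⁻¹) ^ 2 * (4 * b ^ 2) =
      -(1 + b ^ 2) ^ 2 / 4 := by
  have hdiff : ((1 - I * b) / (1 + I * b))⁻¹ - (1 - I * b) / (1 + I * b) =
      4 * I * b / ((1 - I * b) * (1 + I * b)) := by
    field_simp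
    ring
  have hprod : (1 - I * b) * (1 + I * b) = 1 + b ^ 2 := by
    linear_combination -b ^ 2 * I_sq
  rw [hdiff, hprod, inv_div, div_pow, mul_pow, mul_pow, I_sq]
  field_simp

/-- `EF = -(1 + b²)(x₂² + x₃²) / 4`. -/
lemma E_mul_F (b x2 x3 : ℂ) :
    (I / 2 * (1 - I * b) * (x2 + I * x3)) * (I / 2 * (1 + I * b) * (x2 - I * x3)) =
      -(1 + b ^ 2) / 4 * (x2 ^ 2 + x3 ^ 2) := by
  have hprod : (1 - I * b) * (1 + I * b) = 1 + b ^ 2 := by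
    linear_combination -b ^ 2 * I_sq
  have hsum : (x2 + I * x3) * (x2 - I * x3) = x2 ^ 2 + x3 ^ 2 := by
    linear_combination -x3 ^ 2 * I_sq
  rw [← hprod, ← hsum]
  linear_combination
    (1 - I * b) * (1 + I * b) * ((x2 + I * x3) * (x2 - I * x3)) / 4 * I_sq

/-- The degenerate limit `E_dg` of the elliptic curves parametrizing points of the
nondegenerate Sklyanin algebras equals the union `C ∪ C′` of the two conics in the point
scheme of `S`: with `E = (i/2)(1−ib)(x₂+ix₃)`, `F = (i/2)(1+ib)(x₂−ix₃)`, `K = x₀+bx₁`,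
`K′ = x₀−bx₁`, the equations `x₀²+x₁²+x₂²+x₃² = 0` and `x₃²+(1+b²)x₁²+x₂² = 0` hold
simultaneously iff `(K′ = 0 ∧ EF + κ²K² = 0)` or `(K = 0 ∧ EF + κ²K′² = 0)`. -/
theorem stmt_18 (b : ℂ) (hb0 : b ≠ 0) (hbi : b ≠ I) (hbni : b ≠ -I)
    (q κ : ℂ) (hq : q = (1 - I * b) / (1 + I * b)) (hκ : κ = (q⁻¹ - q)⁻¹)
    (x0 x1 x2 x3 : ℂ) :
    (x0 ^ 2 + x1 ^ 2 + x2 ^ 2 + x3 ^ 2 = 0 ∧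
        x3 ^ 2 + (1 + b ^ 2) * x1 ^ 2 + x2 ^ 2 = 0)
      ↔ ((x0 - b * x1 = 0 ∧
            (I / 2 * (1 - I * b) * (x2 + I * x3)) * (I / 2 * (1 + I * b) * (x2 - I * x3))
              + κ ^ 2 * (x0 + b * x1) ^ 2 = 0)
        ∨ (x0 + b * x1 = 0 ∧
            (I / 2 * (1 - I * b) * (x2 + I * x3)) * (I / 2 * (1 + I * b) * (x2 - I * x3))
              + κ ^ 2 * (x0 - b * x1) ^ 2 = 0)) := by
  have hp : 1 + I * b ≠ 0 := fun h => hbi (by linear_combination -I * h + b * I_sq)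
  have hm : 1 - I * b ≠ 0 := fun h => hbni (by linear_combination I * h + b * I_sq)
  have hprod : (1 - I * b) * (1 + I * b) = 1 + b ^ 2 := by
    linear_combination -b ^ 2 * I_sq
  have hc : -(1 + b ^ 2) / 4 ≠ 0 := by
    rw [← hprod]
    exact div_ne_zero (neg_ne_zero.mpr (mul_ne_zero hm hp)) (by norm_num)
  have hκ2 : κ ^ 2 * (4 * b ^ 2) = -(1 + b ^ 2) ^ 2 / 4 := by
    rw [hκ, hq]
    exact kappa_sq_mul b hb0 hp hm
  rw [E_mul_F]
  constructor
  · rintro ⟨h1, h2⟩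
    have h : (x0 - b * x1) * (x0 + b * x1) = 0 := by linear_combination h1 - h2
    rcases mul_eq_zero.mp h with h | h
    · refine Or.inl ⟨h, ?_⟩
      obtain rfl : x0 = b * x1 := sub_eq_zero.mp h
      linear_combination x1 ^ 2 * hκ2 + -(1 + b ^ 2) / 4 * h2
    · refine Or.inr ⟨h, ?_⟩
      obtain rfl : x0 = -(b * x1) := eq_neg_of_add_eq_zero_left h
      linear_combination x1 ^ 2 * hκ2 + -(1 + b ^ 2) / 4 * h2
  · have key : -(1 + b ^ 2) / 4 * (x3 ^ 2 + (1 + b ^ 2) * x1 ^ 2 + x2 ^ 2) = 0 →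
        (x0 - b * x1) * (x0 + b * x1) = 0 →
        x0 ^ 2 + x1 ^ 2 + x2 ^ 2 + x3 ^ 2 = 0 ∧
          x3 ^ 2 + (1 + b ^ 2) * x1 ^ 2 + x2 ^ 2 = 0 := by
      intro h2 h
      have h3 := (mul_eq_zero.mp h2).resolve_left hc
      exact ⟨by linear_combination h + h3, h3⟩
    rintro (⟨h, h2⟩ | ⟨h, h2⟩)
    · refine key ?_ (by rw [h, zero_mul])
      obtain rfl : x0 = b * x1 := sub_eq_zero.mp h
      linear_combination h2 - x1 ^ 2 * hκ2
    · refine key ?_ (by rw [h, mul_zero])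
      obtain rfl : x0 = -(b * x1) := eq_neg_of_add_eq_zero_left h
      linear_combination h2 - x1 ^ 2 * hκ2
end
end
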